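/- Let Ξ = [v_1 ⋯ v_n] be a matrix of direction vectors v_k ∈ ℤ^d ∖ {0} with n ≥ d and Ξ_d := [v_1 ⋯ v_d] nonsingular, and let ρ(Ξ) denote the minimal number of columns that need to be removed from Ξ to obtain a matrix whose columns do not span ℝ^d. Then the integer translates of M_Ξ reproduce all polynomials of total degree ρ(Ξ) − 1: for every polynomial p in d variables of total degree at most ρ(Ξ) − 1 there exist coefficients c : ℤ^d → ℝ such that p(x) = Σ_{i ∈ ℤ^d} c(i) M_Ξ(x − i) for all x ∈ ℝ^d (the sum being locally finite since M_Ξ has compact support). -/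

import Mathlib

open MeasureTheory

open Classical in
/-- The box spline on `d` columns: value `1/|det A|` on `A [0,1)^d`, zero elsewhere. -/
noncomputable def boxSplineBase (d : ℕ) (A : Matrix (Fin d) (Fin d) ℝ)
    (x : Fin d → ℝ) : ℝ :=
  if ∃ u : Fin d → ℝ, (∀ i, 0 ≤ u i ∧ u i < 1) ∧ A.mulVec u = x then |A.det|⁻¹ else 0

/-- The box spline `M_Ξ` associated with direction vectors `v 0, …, v (n-1)` (columns of `Ξ`),
defined by the recursive convolution formula. Junk value `0` when `n < d`. -/
noncomputable def boxSpline (d : ℕ) : (n : ℕ) → (Fin n → Fin d → ℝ) → (Fin d → ℝ) → ℝ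
  | n, v, x =>
    if h : n = d then
      boxSplineBase d (Matrix.of fun i j => v (Fin.cast h.symm j) i) x
    else if hle : n ≤ d then 0
    else
      ∫ t in (0:ℝ)..1,
        boxSpline d (n - 1) (fun k => v (Fin.castLE (Nat.sub_le n 1) k))
          (fun i => x i - t * v ⟨n - 1, Nat.sub_lt (by omega) one_pos⟩ i)
  termination_by n => n
  decreasing_by omega

/-- The real matrix of columns obtained from integer direction vectors. -/
def intCols (d n : ℕ) (v : Fin n → Fin d → ℤ) : Fin n → Fin d → ℝ :=
  fun k i => (v k i : ℝ)

/-- The square matrix `Ξ_d` formed by the first `d` columns. -/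
def leadMat (d n : ℕ) (hdn : d ≤ n) (w : Fin n → Fin d → ℝ) :
    Matrix (Fin d) (Fin d) ℝ :=
  Matrix.of fun i j => w (Fin.castLE hdn j) i

/-- The linear map `t ↦ Ξ t = ∑ k, t k • v k`. -/
def xiVec (d n : ℕ) (w : Fin n → Fin d → ℝ) (t : Fin n → ℝ) : Fin d → ℝ :=
  fun i => ∑ k, t k * w k i

/-- `ρ(Ξ)`: the minimal number of columns that need to be removed from `Ξ` so that the
remaining columns do not span `ℝ^d`. -/
noncomputable def rhoXi (d n : ℕ) (w : Fin n → Fin d → ℝ) : ℕ :=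
  sInf {m : ℕ | ∃ S : Finset (Fin n), S.card = m ∧
    Submodule.span ℝ (w '' ↑(Sᶜ)) ≠ (⊤ : Submodule ℝ (Fin d → ℝ))}

noncomputable section

open Set Filter Topology

local instance : MeasureSpace UnitAddCircle := ⟨AddCircle.haarAddCircle⟩

local instance : Measure.IsAddHaarMeasure (volume : Measure UnitAddCircle) :=
  inferInstanceAs (Measure.IsAddHaarMeasure AddCircle.haarAddCircle)

local instance : IsProbabilityMeasure (volume : Measure UnitAddCircle) :=
  inferInstanceAs (IsProbabilityMeasure AddCircle.haarAddCircle)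

/-- The half-open unit cell `(0,1]^d`. -/
def unitCell (d : ℕ) : Set (Fin d → ℝ) := {x | ∀ k, x k ∈ Ioc (0 : ℝ) 1}

/-- The character `x ↦ exp (2 π i ⟨j, x⟩)` of `ℝ^d`. -/
def latticeChar {d : ℕ} (j : Fin d → ℤ) (x : Fin d → ℝ) : ℂ :=
  Complex.exp (2 * Real.pi * Complex.I * ∑ k, (j k : ℂ) * (x k : ℂ))

lemma mFourier_coe {d : ℕ} (j : Fin d → ℤ) (x : Fin d → ℝ) :
    UnitAddTorus.mFourier j (fun k => (x k : UnitAddCircle)) = latticeChar j x := by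
  simp only [UnitAddTorus.mFourier, ContinuousMap.coe_mk, fourier_coe_apply, latticeChar,
    Finset.mul_sum, Complex.exp_sum]
  refine Finset.prod_congr rfl fun k _ => ?_
  congr 1
  simp
  ring

/-- A function on the torus whose nonzero Fourier coefficients vanish is a.e. constant. -/
lemma ae_eq_of_mFourierCoeff_eq_zero {d : ℕ} {H : UnitAddTorus (Fin d) → ℂ}
    (hH : MemLp H 2 (volume : Measure (UnitAddTorus (Fin d))))
    (h : ∀ j ≠ 0, UnitAddTorus.mFourierCoeff H j = 0) :
    ∀ᵐ y : UnitAddTorus (Fin d), H y = UnitAddTorus.mFourierCoeff H 0 := by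
  have hc : ∀ j, UnitAddTorus.mFourierCoeff (hH.toLp H) j = UnitAddTorus.mFourierCoeff H j := by
    intro j
    refine integral_congr_ae ?_
    filter_upwards [hH.coeFn_toLp] with y hy
    rw [hy]
  have hs := UnitAddTorus.hasSum_mFourier_series_L2 (hH.toLp H)
  simp_rw [hc] at hs
  have h0 := hs.unique (hasSum_single 0 fun j hj => by rw [h j hj, zero_smul])
  have h1 := UnitAddTorus.coeFn_mFourierLp (d := Fin d) 2 0
  have h2 := Lp.coeFn_smul (UnitAddTorus.mFourierCoeff H 0)
    (UnitAddTorus.mFourierLp (d := Fin d) 2 0)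
  rw [← h0] at h2
  filter_upwards [hH.coeFn_toLp, h1, h2] with y a b c
  rw [← a, c, Pi.smul_apply, b, UnitAddTorus.mFourier_zero]
  simp

/-- The representative in `(0,1]^d` of a point of the torus. -/
def cellRep {d : ℕ} (y : UnitAddTorus (Fin d)) : Fin d → ℝ :=
  fun k => (AddCircle.equivIoc 1 0 (y k)).1

lemma measurable_cellRep {d : ℕ} : Measurable (cellRep (d := d)) :=
  measurable_pi_lambda _ fun k => measurable_subtype_coe.comp
    ((AddCircle.measurableEquivIoc 1 0).measurable.comp (measurable_pi_apply k))

lemma cellRep_mem {d : ℕ} (y : UnitAddTorus (Fin d)) : cellRep y ∈ unitCell d := fun k => by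
  simpa [cellRep] using (AddCircle.equivIoc 1 0 (y k)).2

lemma exists_cellRep_coe {d : ℕ} (x : Fin d → ℝ) :
    ∃ i : Fin d → ℤ, cellRep (fun k => (x k : UnitAddCircle)) = fun k => x k - (i k : ℝ) := by
  refine ⟨fun k => toIocDiv one_pos 0 (x k), ?_⟩
  funext k
  have := self_sub_toIocDiv_zsmul (one_pos (α := ℝ)) 0 (x k)
  simp only [zsmul_eq_mul, mul_one] at this
  rw [this]
  rfl

lemma cellRep_coe_of_mem {d : ℕ} {x : Fin d → ℝ} (hx : x ∈ unitCell d) :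
    cellRep (fun k => (x k : UnitAddCircle)) = x := by
  funext k
  simp only [cellRep]
  rw [AddCircle.equivIoc_coe_eq (by simpa using hx k)]

/-- A periodic function whose nonzero Fourier coefficients over the unit cell vanish attains its
mean value on a dense set. -/
lemma dense_setOf_eq_integral_of_periodic {d : ℕ} {F G : (Fin d → ℝ) → ℂ} (hG : Measurable G)
    {C : ℝ} (hC : ∀ x, ‖G x‖ ≤ C)
    (hper : ∀ x (i : Fin d → ℤ), F (fun k => x k - (i k : ℝ)) = F x)
    (hFG : ∀ x ∈ unitCell d, F x = G x)
    (h : ∀ j : Fin d → ℤ, j ≠ 0 → ∫ x in unitCell d, latticeChar j x * G x = 0) :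
    Dense {x | F x = ∫ x in unitCell d, G x} := by
  have hms : MeasurableSet (unitCell d) := MeasurableSet.univ_pi' (fun i => measurableSet_Ioc)
  have hcoef : ∀ j, UnitAddTorus.mFourierCoeff (G ∘ cellRep) j
      = ∫ x in unitCell d, latticeChar (-j) x * G x := by
    intro j
    rw [UnitAddTorus.mFourierCoeff_eq_integral _ _ 0]
    have : {x : Fin d → ℝ | ∀ i, x i ∈ Ioc ((0 : Fin d → ℝ) i) ((0 : Fin d → ℝ) i + 1)}
        = unitCell d := by simp [unitCell]
    rw [this]
    refine setIntegral_congr_fun hms fun x hx => ?_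
    simp only [Function.comp, cellRep_coe_of_mem hx, mFourier_coe, smul_eq_mul]
  have hmem : MemLp (G ∘ cellRep) 2 (volume : Measure (UnitAddTorus (Fin d))) :=
    MemLp.of_bound (hG.comp measurable_cellRep).aestronglyMeasurable C
      (Eventually.of_forall fun y => hC _)
  have hae := ae_eq_of_mFourierCoeff_eq_zero hmem
    fun j hj => by rw [hcoef]; exact h _ (neg_ne_zero.2 hj)
  have h0 : UnitAddTorus.mFourierCoeff (G ∘ cellRep) 0 = ∫ x in unitCell d, G x := by
    rw [hcoef]; simp [latticeChar]
  rw [h0] at hae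
  have hd := Measure.dense_of_ae hae
  have hopen : IsOpenMap (Pi.map (fun (_ : Fin d) (t : ℝ) => (t : UnitAddCircle))) :=
    IsOpenMap.piMap (fun _ => QuotientAddGroup.isOpenMap_coe) (by simp)
  refine (hd.preimage hopen).mono fun x hx => ?_
  obtain ⟨i, hi⟩ := exists_cellRep_coe x
  have hx' : G (cellRep (fun k => (x k : UnitAddCircle))) = ∫ x in unitCell d, G x := hx
  rw [← hFG _ (cellRep_mem _), hi, hper] at hx'
  exact hx'

lemma measurableSet_unitCell (d : ℕ) : MeasurableSet (unitCell d) :=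
  MeasurableSet.univ_pi' (fun _ => measurableSet_Ioc)

/-- The lattice points whose translates of the cube of half-width `R` may meet the unit cell. -/
def cellBox (d : ℕ) (R : ℝ) : Finset (Fin d → ℤ) :=
  Finset.Icc (fun _ => -(⌈R⌉ + 1)) (fun _ => ⌈R⌉ + 1)

lemma mem_cellBox {d : ℕ} {R : ℝ} {x : Fin d → ℝ} (hx : x ∈ unitCell d) {i : Fin d → ℤ}
    (h : ∀ k, |x k - (i k : ℝ)| ≤ R) : i ∈ cellBox d R := by
  rw [cellBox, Finset.mem_Icc]
  refine ⟨fun k => ?_, fun k => ?_⟩ <;>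
  · have h1 := abs_le.1 (h k)
    have h2 := hx k
    have h3 := Int.le_ceil R
    have h4 := h2.1
    have h5 := h2.2
    rify
    linarith

lemma integral_eq_sum_setIntegral_unitCell {d : ℕ} {g : (Fin d → ℝ) → ℂ} {R : ℝ}
    (hg : Integrable g) (hR : ∀ x, g x ≠ 0 → ∀ k, |x k| ≤ R) :
    ∫ x, g x = ∑ i ∈ cellBox d R, ∫ x in unitCell d, g (fun k => x k - (i k : ℝ)) := by
  set s : (Fin d → ℤ) → Set (Fin d → ℝ) :=
    fun i => (fun x k => x k + (i k : ℝ)) ⁻¹' unitCell d with hs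
  have hmeas : ∀ i, MeasurableSet (s i) := fun i =>
    (measurableSet_unitCell d).preimage (by fun_prop)
  have hdisj : Pairwise (Function.onFun Disjoint s) := by
    intro i j hij
    refine Set.disjoint_left.2 fun x hi hj => hij ?_
    funext k
    have h1 := hi k
    have h2 := hj k
    simp only [mem_Ioc] at h1 h2
    have a : (i k : ℝ) < j k + 1 := by linarith
    have b : (j k : ℝ) < i k + 1 := by linarith
    norm_cast at a b
    omega
  have hU : (⋃ i, s i) = univ := by
    refine eq_univ_of_forall fun x => mem_iUnion.2 ⟨fun k => 1 - ⌈x k⌉, fun k => ?_⟩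
    have h1 := Int.le_ceil (x k)
    have h2 := Int.ceil_lt_add_one (x k)
    constructor <;> push_cast <;> linarith
  have key : ∀ i, ∫ x in s i, g x = ∫ x in unitCell d, g (fun k => x k - (i k : ℝ)) := by
    intro i
    rw [← integral_indicator (hmeas i), ← integral_indicator (measurableSet_unitCell d),
      ← integral_sub_right_eq_self _ (fun k => (i k : ℝ))]
    refine integral_congr_ae (Eventually.of_forall fun x => ?_)
    have : (x - fun k => (i k : ℝ)) ∈ s i ↔ x ∈ unitCell d := by
      simp [hs]
    by_cases hx : x ∈ unitCell d
    · simp only [indicator_of_mem hx, indicator_of_mem (this.2 hx)]; rfl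
    · simp only [indicator_of_notMem hx, indicator_of_notMem (mt this.1 hx)]
  calc ∫ x, g x = ∫ x in ⋃ i, s i, g x := by rw [hU, setIntegral_univ]
    _ = ∑' i, ∫ x in s i, g x := integral_iUnion hmeas hdisj hg.integrableOn
    _ = ∑' i : Fin d → ℤ, ∫ x in unitCell d, g (fun k => x k - (i k : ℝ)) := by simp_rw [key]
    _ = _ := by
      refine tsum_eq_sum fun i hi => ?_
      refine setIntegral_eq_zero_of_forall_eq_zero fun x hx => ?_
      by_contra h0
      exact hi (mem_cellBox hx (hR _ h0))

lemma integrable_of_bounded_support {d : ℕ} {g : (Fin d → ℝ) → ℂ} (hg : Measurable g) {C R : ℝ}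
    (hC : ∀ x, ‖g x‖ ≤ C) (hR : ∀ x, g x ≠ 0 → ∀ k, |x k| ≤ R) : Integrable g := by
  have hsub : Function.support g ⊆ Icc (fun _ => -R) (fun _ => R) := fun x hx =>
    ⟨fun k => (abs_le.1 (hR x hx k)).1, fun k => (abs_le.1 (hR x hx k)).2⟩
  rw [← integrableOn_iff_integrable_of_support_subset hsub]
  exact Measure.integrableOn_of_bounded (isCompact_Icc.measure_lt_top).ne
    hg.aestronglyMeasurable (Eventually.of_forall hC)

lemma latticeChar_sub_int {d : ℕ} (j i : Fin d → ℤ) (x : Fin d → ℝ) :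
    latticeChar j (fun k => x k - (i k : ℝ)) = latticeChar j x := by
  simp only [latticeChar]
  rw [Complex.exp_eq_exp_iff_exists_int]
  refine ⟨-∑ k, j k * i k, ?_⟩
  push_cast
  simp only [mul_sub, Finset.sum_sub_distrib]
  ring

lemma norm_latticeChar {d : ℕ} (j : Fin d → ℤ) (x : Fin d → ℝ) : ‖latticeChar j x‖ = 1 := by
  have : latticeChar j x = Complex.exp (((2 * Real.pi * ∑ k, (j k : ℝ) * x k : ℝ) : ℂ)
      * Complex.I) := by
    simp only [latticeChar]; congr 1; push_cast; ring
  rw [this, Complex.norm_exp_ofReal_mul_I]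

lemma continuous_latticeChar {d : ℕ} (j : Fin d → ℤ) : Continuous (latticeChar j) := by
  unfold latticeChar; fun_prop

lemma dense_setOf_finsum_translates_eq_integral {d : ℕ} {g : (Fin d → ℝ) → ℂ} (hg : Measurable g)
    {C R : ℝ} (hC : ∀ x, ‖g x‖ ≤ C) (hR : ∀ x, g x ≠ 0 → ∀ k, |x k| ≤ R)
    (h : ∀ j : Fin d → ℤ, j ≠ 0 → ∫ x, latticeChar j x * g x = 0) :
    Dense {x : Fin d → ℝ | ∑ᶠ i : Fin d → ℤ, g (fun k => x k - (i k : ℝ)) = ∫ x, g x} := by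
  have hgi : ∀ i : Fin d → ℤ, Measurable fun x : Fin d → ℝ => g (fun k => x k - (i k : ℝ)) :=
    fun i => hg.comp (by fun_prop)
  set G : (Fin d → ℝ) → ℂ := fun x => ∑ i ∈ cellBox d R, g (fun k => x k - (i k : ℝ)) with hG
  have hfin : volume (unitCell d) ≠ ⊤ := by
    refine ((measure_mono (t := Icc 0 1) fun x hx => ?_).trans_lt
      isCompact_Icc.measure_lt_top).ne
    exact ⟨fun k => (hx k).1.le, fun k => (hx k).2⟩
  have hint : ∀ j : Fin d → ℤ, ∫ x in unitCell d, latticeChar j x * G x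
      = ∫ x, latticeChar j x * g x := by
    intro j
    have hm : Measurable fun x => latticeChar j x * g x :=
      (continuous_latticeChar j).measurable.mul hg
    have hb : ∀ x, ‖latticeChar j x * g x‖ ≤ C := fun x => by
      rw [norm_mul, norm_latticeChar, one_mul]; exact hC x
    have hR' : ∀ x, latticeChar j x * g x ≠ 0 → ∀ k, |x k| ≤ R := fun x hx =>
      hR x (right_ne_zero_of_mul hx)
    rw [integral_eq_sum_setIntegral_unitCell (integrable_of_bounded_support hm hb hR') hR',
      ← integral_finsetSum]
    · refine setIntegral_congr_fun (measurableSet_unitCell d) fun x _ => ?_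
      simp only [hG, Finset.mul_sum, latticeChar_sub_int]
    · intro i _
      exact Measure.integrableOn_of_bounded hfin (hm.comp (by fun_prop)).aestronglyMeasurable
        (Eventually.of_forall fun x => hb _)
  have h0 : ∫ x in unitCell d, G x = ∫ x, g x := by
    have := hint 0
    simpa [latticeChar] using this
  rw [← h0]
  refine dense_setOf_eq_integral_of_periodic (C := (cellBox d R).card • C)
    (F := fun x => ∑ᶠ i : Fin d → ℤ, g (fun k => x k - (i k : ℝ)))
    (Finset.measurable_fun_sum _ fun i _ => hgi i) ?_ ?_ ?_ ?_
  · exact fun x => (norm_sum_le _ _).trans (Finset.sum_le_card_nsmul _ _ _ fun i _ => hC _)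
  · intro x i
    refine finsum_eq_of_bijective (fun l => i + l) (Equiv.addLeft i).bijective fun l => ?_
    congr 1
    funext k
    push_cast [Pi.add_apply]
    ring
  · intro x hx
    refine finsum_eq_sum_of_support_subset _ fun i hi => ?_
    exact mem_cellBox hx (hR _ hi)
  · intro j hj
    rw [hint j, h j hj]

lemma boxSpline_self (d : ℕ) (w : Fin d → Fin d → ℝ) (x : Fin d → ℝ) :
    boxSpline d d w x = boxSplineBase d (leadMat d d le_rfl w) x := by
  rw [boxSpline, dif_pos rfl]
  rfl

lemma boxSpline_succ {d n : ℕ} (h : d ≤ n) (w : Fin (n + 1) → Fin d → ℝ) (x : Fin d → ℝ) :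
    boxSpline d (n + 1) w x
      = ∫ t in (0 : ℝ)..1, boxSpline d n (fun k => w k.castSucc) (x - t • w (Fin.last n)) := by
  rw [boxSpline, dif_neg (by omega), dif_neg (by omega)]
  rfl

open Classical in
lemma boxSplineBase_eq {d : ℕ} {A : Matrix (Fin d) (Fin d) ℝ} (hA : A.det ≠ 0)
    (x : Fin d → ℝ) :
    boxSplineBase d A x
      = if ∀ i, 0 ≤ A⁻¹.mulVec x i ∧ A⁻¹.mulVec x i < 1 then |A.det|⁻¹ else 0 := by
  have hu : IsUnit A.det := hA.isUnit
  unfold boxSplineBase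
  refine if_congr ⟨?_, fun h => ⟨_, h, ?_⟩⟩ rfl rfl
  · rintro ⟨u, hu1, rfl⟩
    simpa [Matrix.mulVec_mulVec, Matrix.nonsing_inv_mul A hu] using hu1
  · simp [Matrix.mulVec_mulVec, Matrix.mul_nonsing_inv A hu]

lemma measurable_boxSpline {d n : ℕ} (h : d ≤ n) :
    ∀ w : Fin n → Fin d → ℝ, (leadMat d n h w).det ≠ 0 → Measurable (boxSpline d n w) := by
  induction n, h using Nat.le_induction with
  | base =>
    intro w hw
    classical
    have : boxSpline d d w = fun x => if x ∈ {x : Fin d → ℝ | ∀ i,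
        0 ≤ (leadMat d d le_rfl w)⁻¹.mulVec x i ∧ (leadMat d d le_rfl w)⁻¹.mulVec x i < 1}
        then |(leadMat d d le_rfl w).det|⁻¹ else 0 := by
      funext x
      rw [boxSpline_self, boxSplineBase_eq hw]
      rfl
    rw [this]
    refine Measurable.ite ?_ measurable_const measurable_const
    have hc : ∀ i, Measurable fun x : Fin d → ℝ => (leadMat d d le_rfl w)⁻¹.mulVec x i :=
      fun i => (show Continuous fun x : Fin d → ℝ => (leadMat d d le_rfl w)⁻¹.mulVec x i by
        fun_prop).measurable
    simp only [ofPred_forall]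
    exact MeasurableSet.iInter fun i => (measurableSet_le measurable_const (hc i)).inter
      (measurableSet_lt (hc i) measurable_const)
  | succ n h ih =>
    intro w hw
    have : boxSpline d (n + 1) w = fun x => ∫ t in Ioc (0 : ℝ) 1,
        boxSpline d n (fun k => w k.castSucc) (x - t • w (Fin.last n)) := by
      funext x
      rw [boxSpline_succ h, intervalIntegral.integral_of_le zero_le_one]
    rw [this]
    refine (StronglyMeasurable.integral_prod_right ?_).measurable
    exact ((ih (fun k => w k.castSucc) hw).comp (by fun_prop)).stronglyMeasurable

lemma abs_boxSpline_le {d n : ℕ} (h : d ≤ n) :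
    ∀ (w : Fin n → Fin d → ℝ) (x : Fin d → ℝ),
      |boxSpline d n w x| ≤ |(leadMat d n h w).det|⁻¹ := by
  induction n, h using Nat.le_induction with
  | base =>
    intro w x
    rw [boxSpline_self, boxSplineBase]
    split_ifs <;> simp
  | succ n h ih =>
    intro w x
    rw [boxSpline_succ h]
    have := intervalIntegral.norm_integral_le_of_norm_le_const (a := 0) (b := 1)
      (f := fun t => boxSpline d n (fun k => w k.castSucc) (x - t • w (Fin.last n)))
      fun t _ => ih (fun k => w k.castSucc) (x - t • w (Fin.last n))
    simp only [Real.norm_eq_abs, sub_zero, abs_one, mul_one] at this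
    exact this

lemma exists_boxSpline_support_bound {d n : ℕ} (h : d ≤ n) :
    ∀ w : Fin n → Fin d → ℝ, ∃ R, ∀ x, boxSpline d n w x ≠ 0 → ∀ k, |x k| ≤ R := by
  induction n, h using Nat.le_induction with
  | base =>
    intro w
    refine ⟨∑ k, ∑ l, |leadMat d d le_rfl w k l|, fun x hx k => ?_⟩
    rw [boxSpline_self, boxSplineBase] at hx
    split_ifs at hx with h0
    · obtain ⟨u, hu, rfl⟩ := h0
      calc |(leadMat d d le_rfl w).mulVec u k|
          ≤ ∑ l, |leadMat d d le_rfl w k l * u l| :=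
          Finset.abs_sum_le_sum_abs (fun l => leadMat d d le_rfl w k l * u l) Finset.univ
        _ ≤ ∑ l, |leadMat d d le_rfl w k l| := by
          refine Finset.sum_le_sum fun l _ => ?_
          rw [abs_mul]
          exact mul_le_of_le_one_right (abs_nonneg _)
            (abs_le.2 ⟨by linarith [(hu l).1], (hu l).2.le⟩)
        _ ≤ _ := Finset.single_le_sum (f := fun k => ∑ l, |leadMat d d le_rfl w k l|)
          (fun k _ => Finset.sum_nonneg fun l _ => abs_nonneg _) (Finset.mem_univ k)
    · exact absurd rfl hx
  | succ n h ih =>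
    intro w
    obtain ⟨R, hR⟩ := ih fun k => w k.castSucc
    refine ⟨R + ‖w (Fin.last n)‖, fun x hx k => ?_⟩
    by_contra hk
    refine hx ?_
    rw [boxSpline_succ h, intervalIntegral.integral_of_le zero_le_one]
    refine setIntegral_eq_zero_of_forall_eq_zero fun t ht => ?_
    by_contra h0
    have h1 := hR _ h0 k
    have h2 : |x k| ≤ |(x - t • w (Fin.last n)) k| + |t * w (Fin.last n) k| := by
      have := abs_add_le ((x - t • w (Fin.last n)) k) (t * w (Fin.last n) k)
      simpa using this
    have h3 : |t * w (Fin.last n) k| ≤ ‖w (Fin.last n)‖ := by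
      rw [abs_mul]
      refine (mul_le_of_le_one_left (abs_nonneg _) ?_).trans (norm_le_pi_norm (w (Fin.last n)) k)
      exact abs_le.2 ⟨by linarith [ht.1], ht.2⟩
    linarith

/-- The open cone spanned by the columns of `A`. -/
def columnCone {d : ℕ} (A : Matrix (Fin d) (Fin d) ℝ) : Set (Fin d → ℝ) :=
  {x | ∀ i, 0 < A⁻¹.mulVec x i}

lemma isOpen_columnCone {d : ℕ} (A : Matrix (Fin d) (Fin d) ℝ) : IsOpen (columnCone A) := by
  simp only [columnCone, ofPred_forall]
  exact isOpen_iInter_of_finite fun i => isOpen_lt continuous_const (by fun_prop)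

lemma zero_mem_closure_columnCone {d : ℕ} {A : Matrix (Fin d) (Fin d) ℝ} (hA : A.det ≠ 0) :
    0 ∈ closure (columnCone A) := by
  have hl : Tendsto (fun ε : ℝ => ε • A.mulVec 1) (𝓝[>] 0) (𝓝 0) := by
    have : Tendsto (fun ε : ℝ => ε • A.mulVec 1) (𝓝 0) (𝓝 ((0 : ℝ) • A.mulVec 1)) :=
      (continuous_id.smul continuous_const).tendsto _
    rw [zero_smul] at this
    exact this.mono_left nhdsWithin_le_nhds
  refine mem_closure_of_tendsto hl ?_
  filter_upwards [self_mem_nhdsWithin] with ε hε i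
  simpa [Matrix.mulVec_smul, Matrix.mulVec_mulVec, Matrix.nonsing_inv_mul A hA.isUnit] using hε

/-- A box spline is continuous along the cone of its leading columns. -/
lemma tendsto_boxSpline_columnCone {d n : ℕ} (h : d ≤ n) :
    ∀ w : Fin n → Fin d → ℝ, (leadMat d n h w).det ≠ 0 → ∀ x,
      Tendsto (fun y => boxSpline d n w (x + y)) (𝓝[columnCone (leadMat d n h w)] 0)
        (𝓝 (boxSpline d n w x)) := by
  induction n, h using Nat.le_induction with
  | base =>
    intro w hw x
    set A := leadMat d d le_rfl w with hAdef
    have hlim : ∀ i, Tendsto (fun y => A⁻¹.mulVec (x + y) i) (𝓝[columnCone A] 0)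
        (𝓝 (A⁻¹.mulVec x i)) := by
      intro i
      have : Tendsto (fun y => A⁻¹.mulVec (x + y) i) (𝓝 0) (𝓝 (A⁻¹.mulVec (x + 0) i)) :=
        (show Continuous fun y => A⁻¹.mulVec (x + y) i by fun_prop).tendsto _
      rw [add_zero] at this
      exact this.mono_left nhdsWithin_le_nhds
    have hev : ∀ i, ∀ᶠ y in 𝓝[columnCone A] 0,
        (0 ≤ A⁻¹.mulVec (x + y) i ∧ A⁻¹.mulVec (x + y) i < 1 ↔
          0 ≤ A⁻¹.mulVec x i ∧ A⁻¹.mulVec x i < 1) := by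
      intro i
      have hpos : ∀ᶠ y in 𝓝[columnCone A] 0,
          A⁻¹.mulVec x i < A⁻¹.mulVec (x + y) i := by
        filter_upwards [self_mem_nhdsWithin] with y hy
        have := hy i
        rw [Matrix.mulVec_add, Pi.add_apply]
        linarith
      rcases lt_or_ge (A⁻¹.mulVec x i) 0 with h0 | h0
      · filter_upwards [(hlim i).eventually_lt_const h0] with y hy
        constructor <;> intro hh <;> linarith [hh.1]
      · rcases lt_or_ge (A⁻¹.mulVec x i) 1 with h1 | h1
        · filter_upwards [(hlim i).eventually_lt_const h1, hpos] with y hy hy'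
          exact ⟨fun _ => ⟨h0, h1⟩, fun _ => ⟨by linarith, hy⟩⟩
        · filter_upwards [hpos] with y hy
          constructor <;> intro hh <;> linarith [hh.2]
    refine tendsto_const_nhds.congr' ?_
    filter_upwards [eventually_all.2 hev] with y hy
    classical
    rw [boxSpline_self, boxSpline_self, boxSplineBase_eq hw, boxSplineBase_eq hw]
    exact if_congr (forall_congr' fun i => (hy i).symm) rfl rfl
  | succ n h ih =>
    intro w hw x
    simp only [boxSpline_succ h]
    refine intervalIntegral.tendsto_integral_filter_of_dominated_convergence
      (fun _ => |(leadMat d n h fun k => w k.castSucc).det|⁻¹) ?_ ?_ ?_ ?_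
    · exact Eventually.of_forall fun y =>
        ((measurable_boxSpline h (fun k => w k.castSucc) hw).comp (by fun_prop)).aestronglyMeasurable
    · exact Eventually.of_forall fun y => Eventually.of_forall fun t _ =>
        abs_boxSpline_le h _ _
    · exact intervalIntegrable_const
    · refine Eventually.of_forall fun t _ => ?_
      simp only [add_sub_right_comm x]
      exact ih (fun k => w k.castSucc) hw (x - t • w (Fin.last n))

/-- Lebesgue measure on the cube `(0,1]^n`. -/
def cubeMeasure (n : ℕ) : Measure (Fin n → ℝ) :=
  Measure.pi fun _ => volume.restrict (Ioc (0 : ℝ) 1)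

instance (n : ℕ) : IsProbabilityMeasure (cubeMeasure n) := by
  have : IsProbabilityMeasure (volume.restrict (Ioc (0 : ℝ) 1)) := ⟨by simp⟩
  unfold cubeMeasure
  infer_instance

lemma cubeMeasure_eq_restrict (n : ℕ) :
    cubeMeasure n = volume.restrict (univ.pi fun _ => Ioc (0 : ℝ) 1) := by
  rw [cubeMeasure, volume_pi, Measure.restrict_pi_pi]

lemma cubeMeasure_eq_restrict_Ico (n : ℕ) :
    cubeMeasure n = volume.restrict (univ.pi fun _ => Ico (0 : ℝ) 1) := by
  rw [volume_pi, Measure.restrict_pi_pi, cubeMeasure]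
  congr 1
  funext _
  exact Measure.restrict_congr_set Ico_ae_eq_Ioc.symm

lemma integrable_cubeMeasure {n : ℕ} {f : (Fin n → ℝ) → ℂ} (hf : Continuous f) :
    Integrable f (cubeMeasure n) := by
  rw [cubeMeasure_eq_restrict]
  have : IntegrableOn f (Icc 0 1) := hf.continuousOn.integrableOn_compact isCompact_Icc
  exact this.mono_set fun x hx => ⟨fun k => (hx k trivial).1.le, fun k => (hx k trivial).2⟩

lemma continuous_xiVec (d n : ℕ) (w : Fin n → Fin d → ℝ) : Continuous (xiVec d n w) := by
  unfold xiVec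
  fun_prop

lemma integral_cubeMeasure_succ {n : ℕ} {f : (Fin (n + 1) → ℝ) → ℂ} (hf : Continuous f) :
    ∫ t, f t ∂cubeMeasure (n + 1)
      = ∫ s in Ioc (0 : ℝ) 1, ∫ t, f ((Fin.last n).insertNth s t) ∂cubeMeasure n := by
  have hmp := (measurePreserving_piFinSuccAbove
    (fun _ : Fin (n + 1) => volume.restrict (Ioc (0 : ℝ) 1)) (Fin.last n)).symm
  have h1 := hmp.integral_comp' f
  have h2 := (hmp.integrable_comp_emb (MeasurableEquiv.measurableEmbedding _)).2
    (integrable_cubeMeasure hf)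
  rw [cubeMeasure, ← h1]
  exact integral_prod _ h2

lemma integral_continuous_mul_boxSpline {d n : ℕ} (h : d ≤ n) :
    ∀ w : Fin n → Fin d → ℝ, (leadMat d n h w).det ≠ 0 → ∀ f : (Fin d → ℝ) → ℂ, Continuous f →
      ∫ x, f x * (boxSpline d n w x : ℂ) = ∫ t, f (xiVec d n w t) ∂cubeMeasure n := by
  induction n, h using Nat.le_induction with
  | base =>
    intro w hw f hf
    set A := leadMat d d le_rfl w with hA
    set g : (Fin d → ℝ) → ℂ := fun x => f x * (boxSpline d d w x : ℂ) with hg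
    have hgm : Measurable g := hf.measurable.mul
      (Complex.measurable_ofReal.comp (measurable_boxSpline le_rfl w hw))
    have hmap := Real.map_matrix_volume_pi_eq_smul_volume_pi hw
    have h1 : ∫ u, g (Matrix.toLin' A u) = |A.det⁻¹| • ∫ x, g x := by
      rw [← integral_map (φ := Matrix.toLin' A)
        (LinearMap.continuous_of_finiteDimensional _).measurable.aemeasurable
        hgm.aestronglyMeasurable, hmap, integral_smul_measure,
        ENNReal.toReal_ofReal (abs_nonneg _)]
    have hms : MeasurableSet (univ.pi fun _ : Fin d => Ico (0 : ℝ) 1) :=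
      MeasurableSet.univ_pi fun _ => measurableSet_Ico
    have h2 : ∫ u, g (Matrix.toLin' A u)
        = |A.det⁻¹| • ∫ t, f (xiVec d d w t) ∂cubeMeasure d := by
      rw [cubeMeasure_eq_restrict_Ico, ← integral_smul, ← integral_indicator hms]
      refine integral_congr_ae (Eventually.of_forall fun u => ?_)
      have hx : Matrix.toLin' A u = xiVec d d w u := by
        funext i
        simp only [Matrix.toLin'_apply, Matrix.mulVec, dotProduct, xiVec, hA, leadMat,
          Matrix.of_apply]
        exact Finset.sum_congr rfl fun k _ => mul_comm _ _
      have hinv : A⁻¹.mulVec (xiVec d d w u) = u := by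
        rw [← hx]
        simp [Matrix.mulVec_mulVec, Matrix.nonsing_inv_mul A hw.isUnit]
      classical
      simp only [hg, hx, boxSpline_self, boxSplineBase_eq hw, ← hA, hinv]
      by_cases hu : ∀ i, 0 ≤ u i ∧ u i < 1
      · rw [if_pos hu, indicator_of_mem (show u ∈ univ.pi _ from fun i _ => hu i)]
        simp [mul_comm, abs_inv]
      · rw [if_neg hu, indicator_of_notMem (show u ∉ univ.pi _ from fun hh => hu fun i => hh i trivial)]
        simp
    have h0 : |A.det⁻¹| ≠ 0 := abs_ne_zero.2 (inv_ne_zero hw)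
    exact smul_right_injective ℂ h0 (h1.symm.trans h2)
  | succ n h ih =>
    intro w hw f hf
    set w' : Fin n → Fin d → ℝ := fun k => w k.castSucc with hw'
    set v := w (Fin.last n) with hv
    have hm := measurable_boxSpline h w' hw
    obtain ⟨R, hR⟩ := exists_boxSpline_support_bound h w'
    set K : Set (Fin d → ℝ) := Icc (fun _ => -(R + ‖v‖)) (fun _ => R + ‖v‖) with hK
    have hsupp : ∀ x, ∀ t ∈ Ioc (0 : ℝ) 1, boxSpline d n w' (x - t • v) ≠ 0 → x ∈ K := by
      intro x t ht h0
      have h3 : ∀ k, |x k| ≤ R + ‖v‖ := by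
        intro k
        have h1 := hR _ h0 k
        have h2 : |x k| ≤ |(x - t • v) k| + |t * v k| := by
          have := abs_add_le ((x - t • v) k) (t * v k)
          simpa using this
        have h3 : |t * v k| ≤ ‖v‖ := by
          rw [abs_mul]
          refine (mul_le_of_le_one_left (abs_nonneg _) ?_).trans (norm_le_pi_norm v k)
          exact abs_le.2 ⟨by linarith [ht.1], ht.2⟩
        linarith
      exact ⟨fun k => (abs_le.1 (h3 k)).1, fun k => (abs_le.1 (h3 k)).2⟩
    have hint : Integrable (Function.uncurry fun (x : Fin d → ℝ) (t : ℝ) =>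
        f x * (boxSpline d n w' (x - t • v) : ℂ))
        (volume.prod (volume.restrict (Ioc (0 : ℝ) 1))) := by
      have hdom : Integrable (K.indicator fun x => ‖f x‖ * |(leadMat d n h w').det|⁻¹) := by
        rw [integrable_indicator_iff measurableSet_Icc]
        exact (Continuous.continuousOn (by fun_prop)).integrableOn_compact isCompact_Icc
      refine (hdom.comp_fst (volume.restrict (Ioc (0 : ℝ) 1))).mono' ?_ ?_
      · have : Measurable fun z : (Fin d → ℝ) × ℝ =>
            f z.1 * (boxSpline d n w' (z.1 - z.2 • v) : ℂ) :=
          (hf.measurable.comp measurable_fst).mul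
            (Complex.measurable_ofReal.comp (hm.comp (by fun_prop)))
        exact this.aestronglyMeasurable
      · have hae : ∀ᵐ z : (Fin d → ℝ) × ℝ ∂(volume.prod (volume.restrict (Ioc (0 : ℝ) 1))),
            z.2 ∈ Ioc (0 : ℝ) 1 :=
          Measure.quasiMeasurePreserving_snd.ae (ae_restrict_mem measurableSet_Ioc)
        filter_upwards [hae] with z hz
        simp only [Function.uncurry, norm_mul, Complex.norm_real, Real.norm_eq_abs]
        by_cases h0 : boxSpline d n w' (z.1 - z.2 • v) = 0
        · rw [h0]
          simp only [abs_zero, mul_zero]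
          exact indicator_nonneg (fun x _ => by positivity) _
        · rw [indicator_of_mem (hsupp _ _ hz h0)]
          exact mul_le_mul_of_nonneg_left (abs_boxSpline_le h _ _) (norm_nonneg _)
    calc ∫ x, f x * (boxSpline d (n + 1) w x : ℂ)
        = ∫ x, ∫ t in Ioc (0 : ℝ) 1, f x * (boxSpline d n w' (x - t • v) : ℂ) := by
          refine integral_congr_ae (Eventually.of_forall fun x => ?_)
          simp only [boxSpline_succ h]
          rw [intervalIntegral.integral_of_le zero_le_one, integral_const_mul]
          congr 1
          exact integral_ofReal.symm
      _ = ∫ t in Ioc (0 : ℝ) 1, ∫ x, f x * (boxSpline d n w' (x - t • v) : ℂ) :=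
          integral_integral_swap hint
      _ = ∫ t in Ioc (0 : ℝ) 1, ∫ s, f (xiVec d n w' s + t • v) ∂cubeMeasure n := by
          refine integral_congr_ae (Eventually.of_forall fun t => ?_)
          have := ih w' hw (fun x => f (x + t • v)) (by fun_prop)
          have h2 := integral_sub_right_eq_self (μ := volume)
            (fun x => f (x + t • v) * (boxSpline d n w' x : ℂ)) (t • v)
          simp only [sub_add_cancel] at h2
          exact h2.trans this
      _ = _ := by
          rw [integral_cubeMeasure_succ (f := fun t => f (xiVec d (n + 1) w t))
            (hf.comp (continuous_xiVec _ _ _))]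
          refine integral_congr_ae (Eventually.of_forall fun t => ?_)
          refine integral_congr_ae (Eventually.of_forall fun s => ?_)
          beta_reduce
          congr 1
          funext i
          simp [xiVec, Fin.sum_univ_castSucc, hw', hv]

lemma integral_exp_int_eq_zero {m : ℤ} (hm : m ≠ 0) :
    ∫ t in Ioc (0 : ℝ) 1, Complex.exp (2 * Real.pi * Complex.I * (m * (t : ℂ))) = 0 := by
  have hc : (2 * Real.pi * Complex.I * m : ℂ) ≠ 0 :=
    mul_ne_zero Complex.two_pi_I_ne_zero (Int.cast_ne_zero.2 hm)
  rw [← intervalIntegral.integral_of_le zero_le_one]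
  simp_rw [← mul_assoc]
  rw [integral_exp_mul_complex hc]
  have : Complex.exp (2 * Real.pi * Complex.I * m * ((1 : ℝ) : ℂ)) = 1 := by
    rw [Complex.exp_eq_one_iff]
    exact ⟨m, by push_cast; ring⟩
  rw [this]
  simp

/-- A character of the cube is orthogonal to the polynomials of degree less than the number of its
nonzero frequencies. -/
lemma integral_latticeChar_mul_eval_eq_zero {n : ℕ} (θ : Fin n → ℤ) (Q : MvPolynomial (Fin n) ℂ)
    (h : Q.totalDegree < (Finset.univ.filter fun k => θ k ≠ 0).card) :
    ∫ t, latticeChar θ t * MvPolynomial.eval (fun k => (t k : ℂ)) Q ∂cubeMeasure n = 0 := by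
  have hexp : ∀ t : Fin n → ℝ, latticeChar θ t * MvPolynomial.eval (fun k => (t k : ℂ)) Q
      = ∑ a ∈ Q.support, Q.coeff a * ∏ k, (Complex.exp (2 * Real.pi * Complex.I *
          (θ k * (t k : ℂ))) * (t k : ℂ) ^ a k) := by
    intro t
    rw [MvPolynomial.eval_eq', Finset.mul_sum, latticeChar, Finset.mul_sum, Complex.exp_sum]
    refine Finset.sum_congr rfl fun a _ => ?_
    rw [Finset.prod_mul_distrib]
    ring
  simp_rw [hexp]
  rw [integral_finsetSum _ fun a _ => integrable_cubeMeasure (by fun_prop)]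
  refine Finset.sum_eq_zero fun a ha => ?_
  obtain ⟨k, hk, hak⟩ : ∃ k, θ k ≠ 0 ∧ a k = 0 := by
    by_contra! hcon
    refine (lt_of_lt_of_le h ?_).not_ge (MvPolynomial.le_totalDegree ha)
    rw [Finsupp.sum_fintype _ _ fun _ => rfl, Finset.card_eq_sum_ones]
    calc ∑ k ∈ Finset.univ.filter (fun k => θ k ≠ 0), 1
        ≤ ∑ k ∈ Finset.univ.filter (fun k => θ k ≠ 0), a k :=
          Finset.sum_le_sum fun k hk => Nat.one_le_iff_ne_zero.2 (hcon k (by simpa using hk))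
      _ ≤ ∑ k, a k := Finset.sum_le_sum_of_subset (Finset.filter_subset _ _)
  rw [integral_const_mul, cubeMeasure, integral_fintype_prod_eq_prod (fun k s =>
    Complex.exp (2 * Real.pi * Complex.I * (θ k * ((s : ℝ) : ℂ))) * (s : ℂ) ^ a k),
    Finset.prod_eq_zero (Finset.mem_univ k), mul_zero]
  simp only [hak, pow_zero, mul_one]
  exact integral_exp_int_eq_zero hk

lemma latticeChar_xiVec {d n : ℕ} (v : Fin n → Fin d → ℤ) (j : Fin d → ℤ) (t : Fin n → ℝ) :
    latticeChar j (xiVec d n (intCols d n v) t) = latticeChar (fun k => ∑ i, j i * v k i) t := by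
  simp only [latticeChar, xiVec, intCols]
  congr 2
  push_cast
  simp only [Finset.mul_sum, Finset.sum_mul]
  rw [Finset.sum_comm]
  refine Finset.sum_congr rfl fun k _ => Finset.sum_congr rfl fun i _ => ?_
  ring

/-- The Fourier transform of a box spline vanishes to high order at nonzero lattice points. -/
lemma integral_latticeChar_mul_monomial_mul_boxSpline {d n : ℕ} (hdn : d ≤ n)
    (v : Fin n → Fin d → ℤ) (hns : (leadMat d n hdn (intCols d n v)).det ≠ 0) (j : Fin d → ℤ)
    (γ : Fin d → ℕ)
    (h : ∑ i, γ i < (Finset.univ.filter fun k => ∑ i, j i * v k i ≠ 0).card) :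
    ∫ x : Fin d → ℝ, latticeChar j x *
      (((∏ i, x i ^ γ i) * boxSpline d n (intCols d n v) x : ℝ) : ℂ) = 0 := by
  have h1 := integral_continuous_mul_boxSpline hdn _ hns
    (fun x => latticeChar j x * ((∏ i, x i ^ γ i : ℝ) : ℂ))
    ((continuous_latticeChar j).mul (by fun_prop))
  simp only [Complex.ofReal_mul, ← mul_assoc]
  rw [h1]
  set Q : MvPolynomial (Fin n) ℂ :=
    ∏ i, (∑ k, MvPolynomial.C (v k i : ℂ) * MvPolynomial.X k) ^ γ i with hQ
  have hdeg : Q.totalDegree ≤ ∑ i, γ i := by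
    refine (MvPolynomial.totalDegree_finsetProd _ _).trans (Finset.sum_le_sum fun i _ => ?_)
    refine (MvPolynomial.totalDegree_pow _ _).trans ?_
    refine mul_le_of_le_one_right (Nat.zero_le _) ?_
    refine MvPolynomial.totalDegree_finsetSum_le fun k _ => ?_
    refine (MvPolynomial.totalDegree_mul _ _).trans ?_
    rw [MvPolynomial.totalDegree_C, MvPolynomial.totalDegree_X, zero_add]
  rw [← integral_latticeChar_mul_eval_eq_zero _ Q (hdeg.trans_lt h)]
  refine integral_congr_ae (Eventually.of_forall fun t => ?_)
  simp only [latticeChar_xiVec]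
  congr 1
  simp only [hQ, map_prod, map_pow, map_sum, map_mul, MvPolynomial.eval_C, MvPolynomial.eval_X,
    xiVec, intCols]
  push_cast
  refine Finset.prod_congr rfl fun i _ => ?_
  congr 1
  exact Finset.sum_congr rfl fun k _ => mul_comm _ _

lemma integral_boxSpline {d n : ℕ} (hdn : d ≤ n) (w : Fin n → Fin d → ℝ)
    (hns : (leadMat d n hdn w).det ≠ 0) : ∫ x, boxSpline d n w x = 1 := by
  have h1 := integral_continuous_mul_boxSpline hdn w hns (fun _ => 1) continuous_const
  simp only [one_mul, integral_const, probReal_univ, one_smul] at h1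
  rw [integral_complex_ofReal] at h1
  exact_mod_cast h1

lemma rhoXi_le_card {d n : ℕ} (v : Fin n → Fin d → ℤ) {j : Fin d → ℤ} (hj : j ≠ 0) :
    rhoXi d n (intCols d n v) ≤ (Finset.univ.filter fun k => ∑ i, j i * v k i ≠ 0).card := by
  refine Nat.sInf_le ⟨_, rfl, fun htop => hj ?_⟩
  set φ : (Fin d → ℝ) →ₗ[ℝ] ℝ := Fintype.linearCombination ℝ (fun i => (j i : ℝ)) with hφ
  have hle : Submodule.span ℝ (intCols d n v ''
      ↑(Finset.univ.filter fun k => ∑ i, j i * v k i ≠ 0)ᶜ) ≤ LinearMap.ker φ := by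
    rw [Submodule.span_le]
    rintro _ ⟨k, hk, rfl⟩
    have hk' : ∑ i, j i * v k i = 0 := by simpa using hk
    rw [SetLike.mem_coe, LinearMap.mem_ker, hφ, Fintype.linearCombination_apply]
    simp only [intCols, smul_eq_mul]
    rw [← Int.cast_zero, ← hk']
    push_cast
    exact Finset.sum_congr rfl fun i _ => mul_comm _ _
  rw [htop] at hle
  funext i
  have := hle (Submodule.mem_top (x := Pi.single i (1 : ℝ)))
  rw [LinearMap.mem_ker, hφ, Fintype.linearCombination_apply_single] at this
  simpa using this

lemma card_pos_of_ne_zero {d n : ℕ} (hdn : d ≤ n) (v : Fin n → Fin d → ℤ)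
    (hns : (leadMat d n hdn (intCols d n v)).det ≠ 0) {j : Fin d → ℤ} (hj : j ≠ 0) :
    0 < (Finset.univ.filter fun k => ∑ i, j i * v k i ≠ 0).card := by
  rw [Finset.card_pos]
  by_contra hcon
  rw [Finset.not_nonempty_iff_eq_empty, Finset.filter_eq_empty_iff] at hcon
  have h0 := Matrix.eq_zero_of_vecMul_eq_zero hns (v := fun i => (j i : ℝ)) (by
    funext k
    have := not_not.1 (hcon (Finset.mem_univ (Fin.castLE hdn k)))
    simp only [Matrix.vecMul, dotProduct, leadMat, Matrix.of_apply, intCols, Pi.zero_apply]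
    exact_mod_cast this)
  refine hj (funext fun i => ?_)
  simpa using congrFun h0 i

/-- The lattice points `i` for which `x + y - i` may lie in the cube of half-width `R`, for some
`y` in the cube of half-width one. -/
def nearbyLattice {d : ℕ} (R : ℝ) (x : Fin d → ℝ) : Finset (Fin d → ℤ) :=
  Finset.Icc (fun k => ⌊x k - R - 1⌋) (fun k => ⌈x k + R + 1⌉)

lemma mem_nearbyLattice {d : ℕ} {R : ℝ} {x y : Fin d → ℝ} {i : Fin d → ℤ} (hy : ‖y‖ ≤ 1)
    (h : ∀ k, |x k + y k - (i k : ℝ)| ≤ R) : i ∈ nearbyLattice R x := by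
  rw [nearbyLattice, Finset.mem_Icc]
  refine ⟨fun k => ?_, fun k => ?_⟩ <;>
  · have h1 := abs_le.1 (h k)
    have h2 := abs_le.1 ((norm_le_pi_norm y k).trans hy)
    have h3 := Int.le_ceil (x k + R + 1)
    have h4 := Int.floor_le (x k - R - 1)
    rify
    linarith

/-- The moments of the lattice translates of a box spline, of degree below `rhoXi`, are constant. -/
lemma finsum_monomial_mul_boxSpline {d n : ℕ} (hdn : d ≤ n)
    (v : Fin n → Fin d → ℤ) (hns : (leadMat d n hdn (intCols d n v)).det ≠ 0)
    (γ : Fin d → ℕ) (hγ : ∑ i, γ i ≤ rhoXi d n (intCols d n v) - 1) (x : Fin d → ℝ) :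
    ∑ᶠ i : Fin d → ℤ, (∏ k, (x k - (i k : ℝ)) ^ γ k) *
        boxSpline d n (intCols d n v) (fun k => x k - (i k : ℝ))
      = ∫ y : Fin d → ℝ, (∏ k, y k ^ γ k) * boxSpline d n (intCols d n v) y := by
  set w := intCols d n v with hw
  set A := leadMat d n hdn w with hA
  obtain ⟨R, hR⟩ := exists_boxSpline_support_bound hdn w
  set g : (Fin d → ℝ) → ℝ := fun y => (∏ k, y k ^ γ k) * boxSpline d n w y with hg
  have hgR : ∀ y, g y ≠ 0 → ∀ k, |y k| ≤ R := fun y hy => hR y (right_ne_zero_of_mul hy)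
  have hmono : Continuous fun y : Fin d → ℝ => ∏ k, y k ^ γ k := by fun_prop
  have hgm : Measurable g := hmono.measurable.mul (measurable_boxSpline hdn w hns)
  have hgC : ∀ y, ‖((g y : ℝ) : ℂ)‖ ≤ (∏ k, |R| ^ γ k) * |A.det|⁻¹ := by
    intro y
    rw [Complex.norm_real, Real.norm_eq_abs]
    by_cases h0 : g y = 0
    · rw [h0, abs_zero]
      positivity
    · rw [hg]
      simp only [abs_mul, Finset.abs_prod, abs_pow]
      refine mul_le_mul (Finset.prod_le_prod (fun k _ => by positivity) fun k _ => ?_)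
        (abs_boxSpline_le hdn w y) (abs_nonneg _) (by positivity)
      exact pow_le_pow_left₀ (abs_nonneg _) ((hgR y h0 k).trans (le_abs_self R)) _
  set F : (Fin d → ℝ) → ℝ := fun x => ∑ᶠ i : Fin d → ℤ, g (fun k => x k - (i k : ℝ)) with hF
  have hdense : Dense {x | F x = ∫ y, g y} := by
    refine (dense_setOf_finsum_translates_eq_integral (g := fun y => ((g y : ℝ) : ℂ))
      (R := R) (Complex.measurable_ofReal.comp hgm) hgC (fun y hy => hgR y (by simpa using hy))
      fun j hj => ?_).mono fun y hy => ?_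
    · refine integral_latticeChar_mul_monomial_mul_boxSpline hdn v hns j γ ?_
      have h1 := rhoXi_le_card v hj
      have h2 := card_pos_of_ne_zero hdn v hns hj
      rw [← hw] at h1
      omega
    · have hy' : ∑ᶠ i : Fin d → ℤ, ((g (fun k => y k - (i k : ℝ)) : ℝ) : ℂ)
          = ∫ y, ((g y : ℝ) : ℂ) := hy
      rw [integral_complex_ofReal] at hy'
      refine Complex.ofReal_injective (Eq.trans ?_ hy')
      exact AddMonoidHom.map_finsum_of_injective Complex.ofRealHom.toAddMonoidHom
        Complex.ofReal_injective _
  have hsum : ∀ y : Fin d → ℝ, ‖y‖ ≤ 1 →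
      F (x + y) = ∑ i ∈ nearbyLattice R x, g ((x - fun k => (i k : ℝ)) + y) := by
    intro y hy
    have : ∀ i : Fin d → ℤ, (fun k => (x + y) k - (i k : ℝ)) = (x - fun k => (i k : ℝ)) + y :=
      fun i => by funext k; simp only [Pi.add_apply, Pi.sub_apply]; ring
    simp only [hF, this]
    refine finsum_eq_sum_of_support_subset _ fun i hi => ?_
    refine mem_nearbyLattice hy fun k => ?_
    have := hgR _ hi k
    rw [Pi.add_apply, Pi.sub_apply] at this
    rwa [add_sub_right_comm]
  have hball : ∀ᶠ y : Fin d → ℝ in 𝓝 0, ‖y‖ ≤ 1 := by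
    filter_upwards [Metric.closedBall_mem_nhds (0 : Fin d → ℝ) one_pos] with y hy
    simpa using hy
  have hlim : Tendsto (fun y => F (x + y)) (𝓝[columnCone A] 0) (𝓝 (F x)) := by
    have h0 := hsum 0 (by simp)
    rw [add_zero] at h0
    rw [h0]
    have : Tendsto (fun y => ∑ i ∈ nearbyLattice R x, g ((x - fun k => (i k : ℝ)) + y))
        (𝓝[columnCone A] 0) (𝓝 (∑ i ∈ nearbyLattice R x, g ((x - fun k => (i k : ℝ)) + 0))) := by
      refine tendsto_finsetSum _ fun i _ => ?_
      have h1 := tendsto_boxSpline_columnCone hdn w hns (x - fun k => (i k : ℝ))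
      have h2 : Tendsto (fun y : Fin d → ℝ => ∏ k, ((x - fun k => (i k : ℝ)) + y) k ^ γ k)
          (𝓝 0) (𝓝 (∏ k, ((x - fun k => (i k : ℝ)) + 0) k ^ γ k)) :=
        (hmono.comp (continuous_const.add continuous_id)).tendsto 0
      have h3 := (h2.mono_left nhdsWithin_le_nhds).mul h1
      simpa only [hg, add_zero] using h3
    refine this.congr' ?_
    filter_upwards [nhdsWithin_le_nhds hball] with y hy
    exact (hsum y hy).symm
  have hfreq : ∃ᶠ y in 𝓝[columnCone A] 0, F (x + y) = ∫ y, g y := by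
    rw [frequently_iff]
    intro s hs
    obtain ⟨U, hU, h0U, hUs⟩ := mem_nhdsWithin.1 hs
    have hne : (U ∩ columnCone A).Nonempty :=
      mem_closure_iff.1 (zero_mem_closure_columnCone hns) U hU h0U
    have hop : IsOpen (U ∩ columnCone A) := hU.inter (isOpen_columnCone A)
    obtain ⟨y, hy⟩ := hne
    obtain ⟨z, hz1, hz2⟩ := hdense.inter_open_nonempty ((fun z => z - x) ⁻¹' (U ∩ columnCone A))
      (hop.preimage (by fun_prop)) ⟨y + x, by simpa using hy⟩
    exact ⟨z - x, hUs hz1, by simpa using hz2⟩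
  by_contra hne
  have hev : ∀ᶠ y in 𝓝[columnCone A] 0, F (x + y) ≠ ∫ y, g y := hlim.eventually_ne hne
  exact hfreq hev

/-- The functions spanned by the lattice translates of a compactly supported function `M`. -/
def translateSpan {d : ℕ} (M : (Fin d → ℝ) → ℝ)
    (hM : ∀ x : Fin d → ℝ, {i : Fin d → ℤ | M (fun k => x k - (i k : ℝ)) ≠ 0}.Finite) :
    Submodule ℝ ((Fin d → ℝ) → ℝ) where
  carrier := {f | ∃ c : (Fin d → ℤ) → ℝ, ∀ x,
    f x = ∑ᶠ i : Fin d → ℤ, c i * M (fun k => x k - (i k : ℝ))}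
  zero_mem' := ⟨0, fun x => by simp⟩
  add_mem' := by
    rintro f f' ⟨c, hc⟩ ⟨c', hc'⟩
    refine ⟨c + c', fun x => ?_⟩
    rw [Pi.add_apply, hc, hc', ← finsum_add_distrib]
    · simp only [Pi.add_apply, add_mul]
    · exact (hM x).subset fun i hi => right_ne_zero_of_mul hi
    · exact (hM x).subset fun i hi => right_ne_zero_of_mul hi
  smul_mem' := by
    rintro r f ⟨c, hc⟩
    refine ⟨r • c, fun x => ?_⟩
    rw [Pi.smul_apply, hc, smul_finsum]
    simp only [Pi.smul_apply, smul_eq_mul, mul_assoc]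

/-- If the moments up to degree `m` of the lattice translates of `M` are constant and `M` has mean
value one, then the translates of `M` reproduce the monomials up to degree `m`. -/
lemma monomial_mem_translateSpan {d m : ℕ} (M : (Fin d → ℝ) → ℝ)
    (hM : ∀ x : Fin d → ℝ, {i : Fin d → ℤ | M (fun k => x k - (i k : ℝ)) ≠ 0}.Finite)
    (μ : (Fin d → ℕ) → ℝ) (hμ0 : μ 0 = 1)
    (hμ : ∀ γ : Fin d → ℕ, ∑ k, γ k ≤ m → ∀ x : Fin d → ℝ,
      ∑ᶠ i : Fin d → ℤ, (∏ k, (x k - (i k : ℝ)) ^ γ k) * M (fun k => x k - (i k : ℝ)) = μ γ)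
    (α : Fin d → ℕ) (hα : ∑ k, α k ≤ m) :
    (fun x : Fin d → ℝ => ∏ k, x k ^ α k) ∈ translateSpan M hM := by
  induction hs : ∑ k, α k using Nat.strong_induction_on generalizing α with
  | _ s ih =>
  set T := Fintype.piFinset fun k => Finset.range (α k + 1) with hT
  set b : (Fin d → ℕ) → ℝ :=
    fun β => ∏ k, ((-1 : ℝ) ^ (α k - β k) * ((α k).choose (β k) : ℝ)) with hb
  have hbinom : ∀ x y : Fin d → ℝ, ∏ k, (x k - y k) ^ α k
      = ∑ β ∈ T, b β * (∏ k, x k ^ β k) * ∏ k, y k ^ (α k - β k) := by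
    intro x y
    simp_rw [sub_eq_add_neg (x _), add_pow]
    rw [Finset.prod_univ_sum]
    refine Finset.sum_congr rfl fun β _ => ?_
    rw [hb, ← Finset.prod_mul_distrib, ← Finset.prod_mul_distrib]
    refine Finset.prod_congr rfl fun k _ => ?_
    rw [neg_pow (y k)]
    ring
  have hαT : α ∈ T := by simp [hT]
  have hexp : ∀ x : Fin d → ℝ,
      ∑ᶠ i : Fin d → ℤ, (∏ k, (i k : ℝ) ^ α k) * M (fun k => x k - (i k : ℝ))
        = ∑ β ∈ T, b β * μ (fun k => α k - β k) * ∏ k, x k ^ β k := by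
    intro x
    have h1 : ∀ i : Fin d → ℤ, (∏ k, (i k : ℝ) ^ α k) * M (fun k => x k - (i k : ℝ))
        = ∑ β ∈ T, (b β * ∏ k, x k ^ β k) * ((∏ k, (x k - (i k : ℝ)) ^ (α k - β k)) *
          M (fun k => x k - (i k : ℝ))) := by
      intro i
      have := hbinom x fun k => x k - (i k : ℝ)
      simp only [sub_sub_cancel] at this
      rw [this, Finset.sum_mul]
      exact Finset.sum_congr rfl fun β _ => by ring
    simp_rw [h1]
    rw [finsum_sum_comm]
    · refine Finset.sum_congr rfl fun β _ => ?_
      rw [← mul_finsum, hμ (fun k => α k - β k)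
        ((Finset.sum_le_sum fun k _ => Nat.sub_le _ _).trans hα)]
      ring
    · intro β _
      exact (hM x).subset fun i hi => right_ne_zero_of_mul (right_ne_zero_of_mul hi)
  have hbα : b α * μ (fun k => α k - α k) = 1 := by
    have : (fun k => α k - α k) = (0 : Fin d → ℕ) := by funext k; simp
    rw [this, hμ0]
    simp [hb]
  have hdecomp : (fun x : Fin d → ℝ => ∏ k, x k ^ α k)
      = (fun x => ∑ᶠ i : Fin d → ℤ, (∏ k, (i k : ℝ) ^ α k) * M (fun k => x k - (i k : ℝ)))
        - ∑ β ∈ T.erase α, (b β * μ (fun k => α k - β k)) •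
          fun x : Fin d → ℝ => ∏ k, x k ^ β k := by
    funext x
    rw [Pi.sub_apply, hexp, ← Finset.add_sum_erase T _ hαT, hbα, one_mul, Finset.sum_apply]
    simp
  rw [hdecomp]
  refine Submodule.sub_mem _ ⟨fun i => ∏ k, (i k : ℝ) ^ α k, fun x => rfl⟩
    (Submodule.sum_mem _ fun β hβ => Submodule.smul_mem _ _ ?_)
  rw [Finset.mem_erase] at hβ
  have hle : ∀ k, β k ≤ α k := fun k =>
    Nat.lt_succ_iff.1 (Finset.mem_range.1 (Fintype.mem_piFinset.1 hβ.2 k))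
  obtain ⟨k, hk⟩ := Function.ne_iff.1 hβ.1
  have hlt : ∑ k, β k < ∑ k, α k := Finset.sum_lt_sum (fun k _ => hle k)
    ⟨k, Finset.mem_univ k, lt_of_le_of_ne (hle k) hk⟩
  exact ih _ (hs ▸ hlt) β (hlt.le.trans hα) rfl

end

/-- The integer translates of `M_Ξ` reproduce all polynomials of total
degree at most `ρ(Ξ) - 1`: for every such polynomial `p` there are coefficients `c`
with `p(x) = ∑_{i ∈ ℤ^d} c(i) M_Ξ(x - i)` for all `x` (the sum being locally finite). -/
theorem boxSpline_polynomial_reproduction (d n : ℕ) (hdn : d ≤ n)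
    (v : Fin n → Fin d → ℤ) (hv : ∀ k, v k ≠ 0)
    (hns : (leadMat d n hdn (intCols d n v)).det ≠ 0)
    (p : MvPolynomial (Fin d) ℝ)
    (hp : p.totalDegree ≤ rhoXi d n (intCols d n v) - 1) :
    ∃ c : (Fin d → ℤ) → ℝ, ∀ x : Fin d → ℝ,
      {i : Fin d → ℤ |
          c i * boxSpline d n (intCols d n v) (fun j => x j - (i j : ℝ)) ≠ 0}.Finite ∧
        MvPolynomial.eval x p
          = ∑ᶠ i : Fin d → ℤ,
              c i * boxSpline d n (intCols d n v) (fun j => x j - (i j : ℝ)) := by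
  have hM : ∀ x : Fin d → ℝ,
      {i : Fin d → ℤ | boxSpline d n (intCols d n v) (fun k => x k - (i k : ℝ)) ≠ 0}.Finite := by
    intro x
    obtain ⟨R, hR⟩ := exists_boxSpline_support_bound hdn (intCols d n v)
    refine (nearbyLattice R x).finite_toSet.subset fun i hi => ?_
    exact mem_nearbyLattice (y := 0) (by simp) fun k => by simpa using hR _ hi k
  have hmem : (fun x => MvPolynomial.eval x p)
      ∈ translateSpan (boxSpline d n (intCols d n v)) hM := by
    have hsum : (fun x => MvPolynomial.eval x p)
        = ∑ a ∈ p.support, p.coeff a • fun x : Fin d → ℝ => ∏ k, x k ^ a k := by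
      funext x
      rw [MvPolynomial.eval_eq', Finset.sum_apply]
      rfl
    rw [hsum]
    refine Submodule.sum_mem _ fun a ha => Submodule.smul_mem _ _ ?_
    refine monomial_mem_translateSpan _ hM
      (fun γ => ∫ y : Fin d → ℝ, (∏ k, y k ^ γ k) * boxSpline d n (intCols d n v) y)
      ?_ (finsum_monomial_mul_boxSpline hdn v hns) a ?_
    · simpa using integral_boxSpline hdn _ hns
    · refine le_trans ?_ hp
      have := MvPolynomial.le_totalDegree ha
      rwa [Finsupp.sum_fintype _ _ fun _ => rfl] at this
  obtain ⟨c, hc⟩ := hmem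
  exact ⟨c, fun x => ⟨(hM x).subset fun i hi => right_ne_zero_of_mul hi, hc x⟩⟩
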